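/- In the root system B_n realized as {±e_i ± e_j : i ≠ j} ∪ {±e_i} in ℝⁿ, every subset that is itself a root system has type A_{k₁} + ... + A_{k_s} + B_{l₁} + ... + B_{l_p} + D_{m₁} + ... + D_{m_r}, where Σ(k_i + 1) + Σ l_i + Σ m_i ≤ n, with k_i ≥ 0, l_i ≥ 1, m_i ≥ 2. -/

import Mathlib

open scoped RealInnerProductSpace

noncomputable section

/-- The roots of type `Aₖ`, realized in `ℝ^{k+1}` as the vectors `e_i - e_j`, `i ≠ j`. -/
def ARootsM (k : ℕ) : Set (EuclideanSpace ℝ (Fin (k + 1))) :=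
  {v | ∃ i j, i ≠ j ∧
    v = EuclideanSpace.single i (1 : ℝ) - EuclideanSpace.single j (1 : ℝ)}

/-- The roots of type `Dₘ`, realized in `ℝ^m` as the vectors `±e_i ± e_j`, `i ≠ j`. -/
def DRootsM (m : ℕ) : Set (EuclideanSpace ℝ (Fin m)) :=
  {v | ∃ i j, ∃ a b : ℝ, i ≠ j ∧ (a = 1 ∨ a = -1) ∧ (b = 1 ∨ b = -1) ∧
    v = a • EuclideanSpace.single i (1 : ℝ) + b • EuclideanSpace.single j (1 : ℝ)}

/-- The roots of type `B_l`, realized in `ℝ^l`: the long roots `±e_i ± e_j` (`i ≠ j`)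
together with the short roots `±e_i`. -/
def BRootsM (l : ℕ) : Set (EuclideanSpace ℝ (Fin l)) :=
  DRootsM l ∪ {v | ∃ i, ∃ a : ℝ, (a = 1 ∨ a = -1) ∧
    v = a • EuclideanSpace.single i (1 : ℝ)}

/-- The irreducible types occurring in root subsystems of `B_n`. -/
inductive BnRootType
  | A : ℕ → BnRootType
  | B : ℕ → BnRootType
  | D : ℕ → BnRootType

/-- The number of coordinates of `ℝⁿ` used by a component of the given type inside
`B_n`: `k + 1` for `A_k`, `l` for `B_l` and `m` for `D_m`. -/
def rtWeight : BnRootType → ℕ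
  | .A k => k + 1
  | .B l => l
  | .D m => m

/-- The standard model of each type. -/
def modelRoots : (t : BnRootType) → Set (EuclideanSpace ℝ (Fin (rtWeight t)))
  | .A k => ARootsM k
  | .B l => BRootsM l
  | .D m => DRootsM m

section Reflections

variable {V ι : Type*} [NormedAddCommGroup V] [InnerProductSpace ℝ V] {u : ι → V} {Δ : Set V}

/-- Reflection of `±u i ± u k` in the root `±u i ± u j`. -/
lemma reflect_long_long (hu : Orthonormal ℝ u)
    (hrefl : ∀ α ∈ Δ, ∀ β ∈ Δ, β - (2 * ⟪α, β⟫ / ⟪α, α⟫) • α ∈ Δ)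
    {i j k : ι} (hij : i ≠ j) (hik : i ≠ k) (hjk : j ≠ k) {a b c d : ℝ}
    (ha : a = 1 ∨ a = -1) (hb : b = 1 ∨ b = -1)
    (h₁ : a • u i + b • u j ∈ Δ) (h₂ : c • u i + d • u k ∈ Δ) :
    (-(a * b * c)) • u j + d • u k ∈ Δ := by
  have h := hrefl _ h₁ _ h₂
  classical
  have e (x y : ι) : ⟪u x, u y⟫ = if x = y then 1 else 0 := orthonormal_iff_ite.mp hu x y
  have e₁ : 2 * ⟪a • u i + b • u j, c • u i + d • u k⟫ /
      ⟪a • u i + b • u j, a • u i + b • u j⟫ = a * c := by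
    simp only [inner_add_left, inner_add_right, real_inner_smul_left, real_inner_smul_right, e]
    simp only [hij, hik, hjk, hij.symm, if_true, if_false]
    rcases ha with rfl | rfl <;> rcases hb with rfl | rfl <;> ring
  rw [e₁] at h
  convert h using 1
  rcases ha with rfl | rfl <;> module

/-- Reflection of `±u i` in the root `±u i ± u j`. -/
lemma reflect_long_short (hu : Orthonormal ℝ u)
    (hrefl : ∀ α ∈ Δ, ∀ β ∈ Δ, β - (2 * ⟪α, β⟫ / ⟪α, α⟫) • α ∈ Δ)
    {i j : ι} (hij : i ≠ j) {a b c : ℝ} (ha : a = 1 ∨ a = -1) (hb : b = 1 ∨ b = -1)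
    (h₁ : a • u i + b • u j ∈ Δ) (h₂ : c • u i ∈ Δ) :
    (-(a * b * c)) • u j ∈ Δ := by
  have h := hrefl _ h₁ _ h₂
  classical
  have e (x y : ι) : ⟪u x, u y⟫ = if x = y then 1 else 0 := orthonormal_iff_ite.mp hu x y
  have e₁ : 2 * ⟪a • u i + b • u j, c • u i⟫ /
      ⟪a • u i + b • u j, a • u i + b • u j⟫ = a * c := by
    simp only [inner_add_left, inner_add_right, real_inner_smul_left, real_inner_smul_right, e]
    simp only [hij, hij.symm, if_true, if_false]
    rcases ha with rfl | rfl <;> rcases hb with rfl | rfl <;> ring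
  rw [e₁] at h
  convert h using 1
  rcases ha with rfl | rfl <;> module

/-- Reflection of `±u i ± u j` in the root `±u i`. -/
lemma reflect_short_long (hu : Orthonormal ℝ u)
    (hrefl : ∀ α ∈ Δ, ∀ β ∈ Δ, β - (2 * ⟪α, β⟫ / ⟪α, α⟫) • α ∈ Δ)
    {i j : ι} (hij : i ≠ j) {a b : ℝ}
    (h₁ : u i ∈ Δ) (h₂ : a • u i + b • u j ∈ Δ) :
    (-a) • u i + b • u j ∈ Δ := by
  have h := hrefl _ h₁ _ h₂
  classical
  have e (x y : ι) : ⟪u x, u y⟫ = if x = y then 1 else 0 := orthonormal_iff_ite.mp hu x y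
  have e₁ : 2 * ⟪u i, a • u i + b • u j⟫ / ⟪u i, u i⟫ = 2 * a := by
    simp only [inner_add_right, real_inner_smul_right, e]
    simp [hij]
  rw [e₁] at h
  convert h using 1
  module

end Reflections

section Components

variable {V ι : Type*} [AddCommGroup V] [Module ℝ V]

/-- The vectors `±u i ± u j` with `i ≠ j` in `C`. -/
def longRoots (u : ι → V) (C : Set ι) : Set V :=
  {v | ∃ i ∈ C, ∃ j ∈ C, ∃ a b : ℝ, i ≠ j ∧ (a = 1 ∨ a = -1) ∧ (b = 1 ∨ b = -1) ∧
    v = a • u i + b • u j}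

/-- The vectors `±u i` with `i` in `C`. -/
def shortRoots (u : ι → V) (C : Set ι) : Set V :=
  {v | ∃ i ∈ C, ∃ a : ℝ, (a = 1 ∨ a = -1) ∧ v = a • u i}

lemma image_DRootsM {m : ℕ} {u : ι → V} {g : Fin m → ι} (hg : Function.Injective g)
    (F : EuclideanSpace ℝ (Fin m) → V) (hF : IsLinearMap ℝ F)
    (hFg : ∀ k, F (EuclideanSpace.single k 1) = u (g k)) :
    F '' DRootsM m = longRoots u (Set.range g) := by
  ext v
  constructor
  · rintro ⟨_, ⟨i, j, a, b, hij, ha, hb, rfl⟩, rfl⟩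
    exact ⟨g i, ⟨i, rfl⟩, g j, ⟨j, rfl⟩, a, b, hg.ne hij, ha, hb, by
      rw [hF.map_add, hF.map_smul, hF.map_smul, hFg, hFg]⟩
  · rintro ⟨_, ⟨i, rfl⟩, _, ⟨j, rfl⟩, a, b, hij, ha, hb, rfl⟩
    exact ⟨_, ⟨i, j, a, b, fun h => hij (h ▸ rfl), ha, hb, rfl⟩, by
      rw [hF.map_add, hF.map_smul, hF.map_smul, hFg, hFg]⟩

lemma image_BRootsM {m : ℕ} {u : ι → V} {g : Fin m → ι} (hg : Function.Injective g)
    (F : EuclideanSpace ℝ (Fin m) → V) (hF : IsLinearMap ℝ F)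
    (hFg : ∀ k, F (EuclideanSpace.single k 1) = u (g k)) :
    F '' BRootsM m = longRoots u (Set.range g) ∪ shortRoots u (Set.range g) := by
  rw [BRootsM, Set.image_union, image_DRootsM hg F hF hFg]
  congr 1
  ext v
  constructor
  · rintro ⟨_, ⟨i, a, ha, rfl⟩, rfl⟩
    exact ⟨g i, ⟨i, rfl⟩, a, ha, by rw [hF.map_smul, hFg]⟩
  · rintro ⟨_, ⟨i, rfl⟩, a, ha, rfl⟩
    exact ⟨_, ⟨i, a, ha, rfl⟩, by rw [hF.map_smul, hFg]⟩

lemma image_ARootsM {k : ℕ} {u : ι → V} {g : Fin (k + 1) → ι} (hg : Function.Injective g)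
    (F : EuclideanSpace ℝ (Fin (k + 1)) → V) (hF : IsLinearMap ℝ F)
    (hFg : ∀ k, F (EuclideanSpace.single k 1) = u (g k)) :
    F '' ARootsM k = {v | ∃ i ∈ Set.range g, ∃ j ∈ Set.range g, i ≠ j ∧ v = u i - u j} := by
  ext v
  constructor
  · rintro ⟨_, ⟨i, j, hij, rfl⟩, rfl⟩
    exact ⟨g i, ⟨i, rfl⟩, g j, ⟨j, rfl⟩, hg.ne hij, by rw [hF.map_sub, hFg, hFg]⟩
  · rintro ⟨_, ⟨i, rfl⟩, _, ⟨j, rfl⟩, hij, rfl⟩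
    exact ⟨_, ⟨i, j, fun h => hij (h ▸ rfl), rfl⟩, by rw [hF.map_sub, hFg, hFg]⟩

end Components

/-- The linear isometry sending the standard basis to a given orthonormal family. -/
lemma exists_linearIsometry_of_orthonormal {V : Type*} [NormedAddCommGroup V]
    [InnerProductSpace ℝ V] {m : ℕ} {w : Fin m → V} (hw : Orthonormal ℝ w) :
    ∃ F : EuclideanSpace ℝ (Fin m) →ₗᵢ[ℝ] V, ∀ x, F x = ∑ k, x k • w k := by
  let v := EuclideanSpace.basisFun (Fin m) ℝ
  have hv : Orthonormal ℝ v.toBasis := by simp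
  refine ⟨(v.toBasis.constr ℝ w).isometryOfOrthonormal hv ?_, fun x => ?_⟩
  · convert hw
    ext k
    simp
  · simp [v, Module.Basis.constr_apply_fintype]

/-- The part of `Δ` living on a class `C` of mutually connected coordinates is a standard model. -/
lemma exists_type_of_component {V ι : Type*} [NormedAddCommGroup V] [InnerProductSpace ℝ V]
    [Finite ι] {u : ι → V} {Δ : Set V} (hu : Orthonormal ℝ u) (hneg : ∀ α ∈ Δ, -α ∈ Δ)
    (hrefl : ∀ α ∈ Δ, ∀ β ∈ Δ, β - (2 * ⟪α, β⟫ / ⟪α, α⟫) • α ∈ Δ)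
    {C : Set ι} (hC : C.Nonempty) (hsubC : ∀ i ∈ C, ∀ j ∈ C, i ≠ j → u i - u j ∈ Δ) :
    ∃ t : BnRootType,
      (match t with
        | .A _ => True
        | .B l => 1 ≤ l
        | .D m => 2 ≤ m) ∧
      ∃ g : Fin (rtWeight t) → ι, Function.Injective g ∧ Set.range g = C ∧
        ∀ F : EuclideanSpace ℝ (Fin (rtWeight t)) → V, IsLinearMap ℝ F →
          (∀ k, F (EuclideanSpace.single k 1) = u (g k)) →
          F '' modelRoots t = Δ ∩ (longRoots u C ∪ shortRoots u C) := by
  have hpos : 1 ≤ C.ncard := (Set.ncard_pos C.toFinite).2 hC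
  have henum (m : ℕ) (hm : m = C.ncard) :
      ∃ g : Fin m → ι, Function.Injective g ∧ Set.range g = C := by
    have e := (Finite.equivFinOfCardEq (α := C) (n := m) (by rw [hm]; rfl)).symm
    exact ⟨fun k => e k, Subtype.val_injective.comp e.injective, by
      rw [Set.range_comp' Subtype.val e, e.range_eq_univ]; simp⟩
  have hlong (hadd : ∀ i ∈ C, ∀ j ∈ C, i ≠ j → u i + u j ∈ Δ) : longRoots u C ⊆ Δ := by
    rintro _ ⟨i, hi, j, hj, a, b, hij, rfl | rfl, rfl | rfl, rfl⟩
    · simpa using hadd i hi j hj hij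
    · simpa [sub_eq_add_neg] using hsubC i hi j hj hij
    · simpa [sub_eq_add_neg, add_comm] using hsubC j hj i hi hij.symm
    · simpa [add_comm] using hneg _ (hadd i hi j hj hij)
  by_cases hS : ∃ i ∈ C, u i ∈ Δ
  · obtain ⟨i, hi, hiΔ⟩ := hS
    have hall : ∀ j ∈ C, u j ∈ Δ := by
      intro j hj
      by_cases hij : i = j
      · exact hij ▸ hiΔ
      · have := reflect_long_short (a := 1) (b := -1) (c := 1) hu hrefl hij (by simp) (by simp)
          (by simpa [sub_eq_add_neg] using hsubC i hi j hj hij) (by simpa using hiΔ)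
        simpa using this
    have hadd : ∀ i ∈ C, ∀ j ∈ C, i ≠ j → u i + u j ∈ Δ := by
      intro i hi j hj hij
      have := reflect_short_long (a := -1) (b := 1) hu hrefl hij (hall i hi)
        (by simpa [sub_eq_add_neg, add_comm] using hsubC j hj i hi hij.symm)
      simpa using this
    have hshort : shortRoots u C ⊆ Δ := by
      rintro _ ⟨i, hi, a, rfl | rfl, rfl⟩
      · simpa using hall i hi
      · simpa using hneg _ (hall i hi)
    obtain ⟨g, hg, hgC⟩ := henum C.ncard rfl
    refine ⟨.B C.ncard, hpos, g, hg, hgC, fun F hF hFg => ?_⟩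
    rw [Set.inter_eq_right.2 (Set.union_subset (hlong hadd) hshort)]
    exact (image_BRootsM hg F hF hFg).trans (by rw [hgC])
  have hnoshort : ∀ v ∈ Δ, v ∉ shortRoots u C := by
    rintro _ hv ⟨i, hi, a, rfl | rfl, rfl⟩
    · exact hS ⟨i, hi, by simpa using hv⟩
    · exact hS ⟨i, hi, by simpa using hneg _ hv⟩
  by_cases hD : ∃ i ∈ C, ∃ j ∈ C, i ≠ j ∧ u i + u j ∈ Δ
  · obtain ⟨i, hi, j, hj, hij, hijΔ⟩ := hD
    have step : ∀ i ∈ C, ∀ j ∈ C, ∀ k ∈ C, i ≠ j → k ≠ j → u i + u j ∈ Δ → u k + u j ∈ Δ := by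
      intro i hi j hj k hk hij hkj h
      by_cases hik : i = k
      · exact hik ▸ h
      · have := reflect_long_long (a := 1) (b := -1) (c := 1) (d := 1) hu hrefl hik hij hkj
          (by simp) (by simp)
          (by simpa [sub_eq_add_neg] using hsubC i hi k hk hik) (by simpa using h)
        simpa using this
    have hadd : ∀ k ∈ C, ∀ l ∈ C, k ≠ l → u k + u l ∈ Δ := by
      intro k hk l hl hkl
      by_cases hkj : k = j
      · subst hkj
        rw [add_comm]
        exact step i hi k hj l hl hij hkl.symm hijΔ
      · have h := step i hi j hj k hk hij hkj hijΔ
        rw [add_comm] at h ⊢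
        exact step j hj k hk l hl (Ne.symm hkj) hkl.symm h
    obtain ⟨g, hg, hgC⟩ := henum C.ncard rfl
    have htwo : 2 ≤ C.ncard := (Set.one_lt_ncard C.toFinite).2 ⟨i, hi, j, hj, hij⟩
    refine ⟨.D C.ncard, htwo, g, hg, hgC, fun F hF hFg => ?_⟩
    have : Δ ∩ (longRoots u C ∪ shortRoots u C) = longRoots u C := by
      ext v
      exact ⟨fun h => h.2.resolve_right (hnoshort v h.1), fun h => ⟨hlong hadd h, .inl h⟩⟩
    rw [this]
    exact (image_DRootsM hg F hF hFg).trans (by rw [hgC])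
  · obtain ⟨g, hg, hgC⟩ := henum (C.ncard - 1 + 1) (by omega)
    refine ⟨.A (C.ncard - 1), trivial, g, hg, hgC, fun F hF hFg => ?_⟩
    refine (image_ARootsM hg F hF hFg).trans ?_
    rw [hgC]
    ext v
    constructor
    · rintro ⟨i, hi, j, hj, hij, rfl⟩
      exact ⟨hsubC i hi j hj hij, .inl ⟨i, hi, j, hj, 1, -1, hij, by simp, by simp, by
        simp [sub_eq_add_neg]⟩⟩
    · rintro ⟨hv, h⟩
      obtain ⟨i, hi, j, hj, a, b, hij, rfl | rfl, rfl | rfl, rfl⟩ :=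
        h.resolve_right (hnoshort v hv)
      · exact (hD ⟨i, hi, j, hj, hij, by simpa using hv⟩).elim
      · exact ⟨i, hi, j, hj, hij, by simp [sub_eq_add_neg]⟩
      · exact ⟨j, hj, i, hi, hij.symm, by simp [sub_eq_add_neg, add_comm]⟩
      · exact (hD ⟨i, hi, j, hj, hij, by simpa [add_comm] using hneg _ hv⟩).elim

/-- Two coordinates are connected when they are equal or a long root of `Δ` joins them. -/
def connectedSetoid {V ι : Type*} [NormedAddCommGroup V] [InnerProductSpace ℝ V] {u : ι → V}
    {Δ : Set V} (hu : Orthonormal ℝ u)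
    (hrefl : ∀ α ∈ Δ, ∀ β ∈ Δ, β - (2 * ⟪α, β⟫ / ⟪α, α⟫) • α ∈ Δ) : Setoid ι where
  r i j := i = j ∨ ∃ a b : ℝ, (a = 1 ∨ a = -1) ∧ (b = 1 ∨ b = -1) ∧ a • u i + b • u j ∈ Δ
  iseqv :=
    { refl := fun _ => .inl rfl
      symm := by
        rintro i j (rfl | ⟨a, b, ha, hb, h⟩)
        · exact .inl rfl
        · exact .inr ⟨b, a, hb, ha, by rwa [add_comm]⟩
      trans := by
        rintro i j k (rfl | ⟨a, b, ha, hb, h⟩) (rfl | ⟨c, d, hc, hd, h'⟩)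
        · exact .inl rfl
        · exact .inr ⟨c, d, hc, hd, h'⟩
        · exact .inr ⟨a, b, ha, hb, h⟩
        · by_cases hij : i = j
          · subst hij
            exact .inr ⟨c, d, hc, hd, h'⟩
          by_cases hjk : j = k
          · subst hjk
            exact .inr ⟨a, b, ha, hb, h⟩
          by_cases hik : i = k
          · exact .inl hik
          rw [add_comm] at h
          refine .inr ⟨_, d, ?_, hd,
            reflect_long_long hu hrefl (Ne.symm hij) hjk hik hb ha h h'⟩
          rcases ha with rfl | rfl <;> rcases hb with rfl | rfl <;> rcases hc with rfl | rfl <;>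
            norm_num }

/-- After changing the signs of the basis vectors, any two connected coordinates `i ≠ j` satisfy
`u i - u j ∈ Δ`. -/
lemma exists_signs {V ι : Type*} [NormedAddCommGroup V] [InnerProductSpace ℝ V] {u : ι → V}
    {Δ : Set V} (hu : Orthonormal ℝ u) (hneg : ∀ α ∈ Δ, -α ∈ Δ)
    (hrefl : ∀ α ∈ Δ, ∀ β ∈ Δ, β - (2 * ⟪α, β⟫ / ⟪α, α⟫) • α ∈ Δ) :
    ∃ s : ι → ℝ, (∀ i, s i = 1 ∨ s i = -1) ∧
      ∀ i j, (connectedSetoid hu hrefl) i j → i ≠ j → s i • u i - s j • u j ∈ Δ := by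
  classical
  let S := connectedSetoid hu hrefl
  let r : ι → ι := fun i => (Quotient.mk S i).out
  have hr (i : ι) : S (r i) i := Quotient.mk_out i
  let s : ι → ℝ := fun j => if r j ≠ j ∧ u (r j) - u j ∉ Δ then -1 else 1
  have hs (i : ι) : s i = 1 ∨ s i = -1 := by
    dsimp only [s]
    split_ifs <;> simp
  have hroot (j : ι) (hj : r j ≠ j) : u (r j) - s j • u j ∈ Δ := by
    by_cases h : u (r j) - u j ∈ Δ
    · simp [s, h]
    · have : s j = -1 := by simp [s, h, hj]
      rw [this]
      obtain h0 | ⟨a, b, rfl | rfl, rfl | rfl, h'⟩ := hr j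
      · exact (hj h0).elim
      · simpa using h'
      · exact (h (by simpa [sub_eq_add_neg] using h')).elim
      · exact (h (by simpa [sub_eq_add_neg, add_comm] using hneg _ h')).elim
      · simpa [add_comm] using hneg _ h'
  have hrep (j : ι) (hj : r j = j) : s j = 1 := by simp [s, hj]
  refine ⟨s, hs, fun i j hS hij => ?_⟩
  have hrij : r i = r j := congrArg Quotient.out (Quotient.sound hS)
  by_cases hi : r i = i
  · have h := hroot j (by rwa [← hrij, hi])
    rw [← hrij, hi] at h
    simpa [hrep i hi] using h
  by_cases hj : r j = j
  · have h := hneg _ (hroot i hi)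
    rw [hrij, hj] at h
    simpa [hrep j hj] using h
  have h₁ := hroot i hi
  have h₂ := hroot j hj
  rw [← hrij] at h₂
  have h := reflect_long_long (a := 1) (b := -s i) (c := 1) (d := -s j) hu hrefl hi
    (by rwa [hrij]) hij (.inl rfl) (by rcases hs i with h | h <;> simp [h])
    (by simpa [sub_eq_add_neg] using h₁) (by simpa [sub_eq_add_neg] using h₂)
  simpa [sub_eq_add_neg] using h

/-- every subset of the root system `B_n` which is itself a root system
(closed under negation and its own reflections) is of type
`A_{k₁} + ⋯ + A_{k_s} + B_{l₁} + ⋯ + B_{l_p} + D_{m₁} + ⋯ + D_{m_r}` with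
`Σ(k_i + 1) + Σ l_i + Σ m_i ≤ n`, `k_i ≥ 0`, `l_i ≥ 1`, `m_i ≥ 2`: it decomposes into
mutually orthogonal components, each the image of a standard model of type `A`, `B`
or `D` under a linear isometry. -/
theorem stmt_5 (n : ℕ) (Δ₁ : Set (EuclideanSpace ℝ (Fin n))) (hsub : Δ₁ ⊆ BRootsM n)
    (hneg : ∀ α ∈ Δ₁, -α ∈ Δ₁)
    (hrefl : ∀ α ∈ Δ₁, ∀ β ∈ Δ₁, β - (2 * ⟪α, β⟫ / ⟪α, α⟫) • α ∈ Δ₁) :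
    ∃ (s : ℕ) (t : Fin s → BnRootType),
      (∀ i, match t i with
        | .A _ => True
        | .B l => 1 ≤ l
        | .D m => 2 ≤ m) ∧
      (∑ i, rtWeight (t i)) ≤ n ∧
      ∃ f : (i : Fin s) →
          (EuclideanSpace ℝ (Fin (rtWeight (t i))) →ₗᵢ[ℝ] EuclideanSpace ℝ (Fin n)),
        (∀ i j, i ≠ j → ∀ x y, ⟪f i x, f j y⟫ = 0) ∧
        Δ₁ = ⋃ i, f i '' modelRoots (t i) := by
  classical
  have he : Orthonormal ℝ (fun i : Fin n => EuclideanSpace.single i (1 : ℝ)) :=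
    EuclideanSpace.orthonormal_single
  let S := connectedSetoid he hrefl
  obtain ⟨σ, hσ, hσΔ⟩ := exists_signs he hneg hrefl
  have hσσ (i : Fin n) : σ i * σ i = 1 := by rcases hσ i with h | h <;> simp [h]
  let u : Fin n → EuclideanSpace ℝ (Fin n) := fun i => σ i • EuclideanSpace.single i (1 : ℝ)
  have hu : Orthonormal ℝ u := by
    rw [orthonormal_iff_ite] at he ⊢
    intro i j
    simp only [u, real_inner_smul_left, real_inner_smul_right, he]
    split_ifs with h
    · subst h
      simp [hσσ]
    · simp
  have hsmul (i : Fin n) (a : ℝ) : a • EuclideanSpace.single i (1 : ℝ) = (a * σ i) • u i := by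
    simp only [u, smul_smul, mul_assoc, hσσ, mul_one]
  have hsign (i : Fin n) {a : ℝ} (ha : a = 1 ∨ a = -1) : a * σ i = 1 ∨ a * σ i = -1 := by
    rcases ha with rfl | rfl <;> rcases hσ i with h | h <;> simp [h]
  let C : Quotient S → Set (Fin n) := fun q => {i | Quotient.mk S i = q}
  have hC (q : Quotient S) : (C q).Nonempty := Quotient.exists_rep q
  choose T hT g hg hgC himage using fun q => exists_type_of_component hu hneg hrefl (hC q)
    (fun i hi j hj hij => hσΔ i j (Quotient.exact (hi.trans hj.symm)) hij)
  choose f hf using fun q => exists_linearIsometry_of_orthonormal (hu.comp (g q) (hg q))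
  have hfg (q : Quotient S) (k) : f q (EuclideanSpace.single k 1) = u (g q k) := by
    rw [hf, Finset.sum_eq_single k] <;> simp +contextual
  have hgq (q : Quotient S) (k) : Quotient.mk S (g q k) = q :=
    (hgC q).subset (Set.mem_range_self k)
  have hinj : Function.Injective (fun p : (q : Quotient S) × Fin (rtWeight (T q)) =>
      g p.1 p.2) := by
    rintro ⟨q, k⟩ ⟨q', k'⟩ h
    obtain rfl : q = q' := by
      rw [← hgq q k, ← hgq q' k']
      exact congrArg _ h
    exact congrArg _ (hg q h)
  let e := (Fintype.equivFin (Quotient S)).symm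
  refine ⟨_, fun i => T (e i), fun i => hT (e i), ?_, fun i => f (e i), ?_, ?_⟩
  · rw [e.sum_comp (fun q => rtWeight (T q))]
    simpa using Fintype.card_le_of_injective _ hinj
  · intro i j hij x y
    rw [hf, hf, sum_inner]
    refine Finset.sum_eq_zero fun k _ => ?_
    rw [inner_sum]
    refine Finset.sum_eq_zero fun l _ => ?_
    have : g (e i) k ≠ g (e j) l := fun h => hij (e.injective (by
      rw [← hgq (e i) k, h, hgq]))
    simp [real_inner_smul_left, real_inner_smul_right, hu.2 this]
  · rw [e.surjective.iUnion_comp (fun q => f q '' modelRoots (T q))]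
    simp only [fun q => himage q (f q) (f q).toLinearMap.isLinear (hfg q)]
    rw [← Set.inter_iUnion, eq_comm, Set.inter_eq_left]
    intro v hv
    rw [Set.mem_iUnion]
    obtain ⟨i, j, a, b, hij, ha, hb, rfl⟩ | ⟨i, a, ha, rfl⟩ := hsub hv
    · exact ⟨Quotient.mk S i, .inl ⟨i, rfl, j, Quotient.sound (.inr ⟨b, a, hb, ha, by
        rwa [add_comm]⟩), a * σ i, b * σ j, hij, hsign i ha, hsign j hb, by
        rw [hsmul i, hsmul j]⟩⟩
    · exact ⟨Quotient.mk S i, .inr ⟨i, rfl, a * σ i, hsign i ha, hsmul i a⟩⟩
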